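/- Let τ be a real number with 0 < τ, let S₁, …, S_t be pairwise disjoint nonempty finite sets of points, and let S = S₁ ∪ ⋯ ∪ S_t. Let D be the set of colors c such that c τ-dominates S_i for at least one index i. Then every color that τ-dominates S belongs to D, and |D| ≤ t/τ. -/

import Mathlib

/-- A color `c` τ-dominates a finite set `S` of points (colored via `col`) if the
number of points of `S` with color `c` is at least `τ · |S|` (as real numbers). -/
def Dominates {α C : Type*} [DecidableEq C] (τ : ℝ) (col : α → C) (c : C)
    (S : Finset α) : Prop :=
  τ * (S.card : ℝ) ≤ ((S.filter (fun p => col p = c)).card : ℝ)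

/-- A color dominating a disjoint union of a nonempty family dominates one of the parts. -/
theorem Dominates.exists_of_biUnion {ι α C : Type*} [DecidableEq α] [DecidableEq C]
    {τ : ℝ} {col : α → C} {c : C} {s : Finset ι} (hs : s.Nonempty) {S : ι → Finset α}
    (hdisj : (s : Set ι).PairwiseDisjoint S) (h : Dominates τ col c (s.biUnion S)) :
    ∃ i ∈ s, Dominates τ col c (S i) := by
  unfold Dominates at *
  rw [Finset.filter_biUnion, Finset.card_biUnion hdisj, Finset.card_biUnion fun i hi j hj hij =>
    Finset.disjoint_filter_filter (hdisj hi hj hij)] at h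
  push_cast at h
  rw [Finset.mul_sum] at h
  exact Finset.exists_le_of_sum_le hs h

/-- At most `1 / τ` colors dominate a nonempty finite set. -/
theorem card_le_of_forall_dominates {α C : Type*} [DecidableEq C] {τ : ℝ} (hτ : 0 < τ)
    {col : α → C} {S : Finset α} (hS : S.Nonempty) {D : Finset C}
    (hD : ∀ c ∈ D, Dominates τ col c S) : (D.card : ℝ) ≤ 1 / τ := by
  have hpos : (0 : ℝ) < S.card := by exact_mod_cast hS.card_pos
  have hsum : ∑ c ∈ D, (S.filter (fun p => col p = c)).card ≤ S.card :=
    (Finset.sum_card_fiberwise_eq_card_filter S D col).trans_le (Finset.card_filter_le _ _)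
  have hle : (D.card : ℝ) * (τ * S.card) ≤ S.card := calc
    (D.card : ℝ) * (τ * S.card) = ∑ _c ∈ D, τ * (S.card : ℝ) := by simp
    _ ≤ ∑ c ∈ D, ((S.filter (fun p => col p = c)).card : ℝ) := Finset.sum_le_sum hD
    _ ≤ S.card := by exact_mod_cast hsum
  rw [le_div_iff₀ hτ]
  exact le_of_mul_le_mul_right (by linarith) hpos

/-- Let `0 < τ`, let `S₁, …, S_t` be pairwise disjoint nonempty finite sets with
union `S`, and let `D` be the set of colors that τ-dominate at least one `S_i`.
Then every color that τ-dominates `S` belongs to `D`, and `|D| ≤ t/τ`. -/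
theorem candidate_set_complete_and_small {α C : Type*} [DecidableEq α] [DecidableEq C]
    (τ : ℝ) (hτ : 0 < τ) (col : α → C) (t : ℕ) (ht : 1 ≤ t)
    (S : Fin t → Finset α)
    (hdisj : ∀ i j, i ≠ j → Disjoint (S i) (S j))
    (hne : ∀ i, (S i).Nonempty)
    (D : Finset C)
    (hD : ∀ c : C, c ∈ D ↔ ∃ i : Fin t, Dominates τ col c (S i)) :
    (∀ c : C, Dominates τ col c (Finset.univ.biUnion S) → c ∈ D) ∧
      (D.card : ℝ) ≤ t / τ := by
  classical
  refine ⟨fun c hc => ?_, ?_⟩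
  · have : NeZero t := ⟨by omega⟩
    obtain ⟨i, -, hi⟩ := hc.exists_of_biUnion Finset.univ_nonempty
      fun i _ j _ hij => hdisj i j hij
    exact (hD c).2 ⟨i, hi⟩
  · have hcover : D ⊆ Finset.univ.biUnion fun i => D.filter fun c => Dominates τ col c (S i) := by
      intro c hc
      obtain ⟨i, hi⟩ := (hD c).1 hc
      exact Finset.mem_biUnion.2 ⟨i, Finset.mem_univ i, Finset.mem_filter.2 ⟨hc, hi⟩⟩
    calc (D.card : ℝ)
        ≤ ∑ i, ((D.filter fun c => Dominates τ col c (S i)).card : ℝ) := by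
          exact_mod_cast (Finset.card_le_card hcover).trans Finset.card_biUnion_le
      _ ≤ ∑ _i : Fin t, 1 / τ := Finset.sum_le_sum fun i _ =>
          card_le_of_forall_dominates hτ (hne i) fun c hc => (Finset.mem_filter.1 hc).2
      _ = t / τ := by simp [div_eq_mul_inv]
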